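/- Let (α_n) be a sequence with α_n > −1 such that α_n/n → ∞ as n → ∞. Let r_n and s_n denote, respectively, the smallest and largest zero of L_n^{(α_n)}. Then lim_{n→∞} (s_n − α_n)/√(n·α_n) = 2 and lim_{n→∞} (r_n − α_n)/√(n·α_n) = −2. Moreover, the closure of the set ⋃_{n≥1} { (x − α_n)/√(n·α_n) : L_n^{(α_n)}(x) = 0 } contains the interval [−2, 2]. -/

import Mathlib

open Filter Topology

/-- Generalized binomial coefficient C(t, m) = t(t-1)⋯(t-m+1)/m! for real t. -/
noncomputable def genBinom (t : ℝ) (m : ℕ) : ℝ :=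
  (∏ i ∈ Finset.range m, (t - (i : ℝ))) / (Nat.factorial m)

/-- Laguerre polynomial L_n^{(α)}. -/
noncomputable def laguerreL (n : ℕ) (α : ℝ) (x : ℝ) : ℝ :=
  ∑ k ∈ Finset.range (n + 1),
    (-1) ^ k * genBinom ((n : ℝ) + α) (n - k) * x ^ k / (Nat.factorial k)

/-- Number of zeros of L_n^{(α)} that are ≤ ξ. -/
noncomputable def laguerreN (n : ℕ) (α ξ : ℝ) : ℕ :=
  {x : ℝ | laguerreL n α x = 0 ∧ x ≤ ξ}.ncard

open Polynomial in
/-- The Laguerre polynomial as an element of `ℝ[X]`. -/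
noncomputable def laguerrePoly (n : ℕ) (α : ℝ) : Polynomial ℝ :=
  ∑ k ∈ Finset.range (n + 1),
    monomial k ((-1) ^ k * genBinom ((n : ℝ) + α) (n - k) / (Nat.factorial k))

theorem laguerrePoly_eval (n : ℕ) (α x : ℝ) : (laguerrePoly n α).eval x = laguerreL n α x := by
  simp only [laguerrePoly, laguerreL, Polynomial.eval_finsetSum, Polynomial.eval_monomial]
  refine Finset.sum_congr rfl fun k _ => ?_
  ring

theorem laguerrePoly_coeff (n : ℕ) (α : ℝ) (k : ℕ) :
    (laguerrePoly n α).coeff k =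
      if k ≤ n then (-1) ^ k * genBinom ((n : ℝ) + α) (n - k) / (Nat.factorial k) else 0 := by
  simp [laguerrePoly, Polynomial.finsetSum_coeff, Polynomial.coeff_monomial]

theorem laguerrePoly_ne_zero (n : ℕ) (α : ℝ) : laguerrePoly n α ≠ 0 := by
  intro h
  have h1 := laguerrePoly_coeff n α n
  rw [h] at h1
  have h2 : (Nat.factorial n : ℝ) ≠ 0 := by exact_mod_cast Nat.factorial_ne_zero n
  simp [genBinom] at h1
  exact div_ne_zero (pow_ne_zero n (by norm_num)) h2 h1.symm

theorem genBinom_succ (t : ℝ) (m : ℕ) :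
    ((m : ℝ) + 1) * genBinom t (m + 1) = (t - m) * genBinom t m := by
  have : (Nat.factorial m : ℝ) ≠ 0 := by exact_mod_cast Nat.factorial_ne_zero m
  have h2 : (m : ℝ) + 1 ≠ 0 := by positivity
  simp only [genBinom, Finset.prod_range_succ, Nat.factorial_succ, Nat.cast_mul, Nat.cast_succ]
  field_simp

theorem laguerrePoly_coeff_succ (n : ℕ) (α : ℝ) (k : ℕ) :
    ((k : ℝ) + 1) * (k + 1 + α) * (laguerrePoly n α).coeff (k + 1)
      + ((n : ℝ) - k) * (laguerrePoly n α).coeff k = 0 := by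
  simp only [laguerrePoly_coeff]
  rcases lt_trichotomy k n with h | h | h
  · obtain ⟨m, rfl⟩ : ∃ m, n = k + 1 + m := ⟨n - (k + 1), by omega⟩
    have e1 : k + 1 + m - (k + 1) = m := by omega
    have e2 : k + 1 + m - k = m + 1 := by omega
    have hg := genBinom_succ (((k + 1 + m : ℕ) : ℝ) + α) m
    rw [if_pos (by omega), if_pos (by omega), e1, e2]
    have hk : (Nat.factorial k : ℝ) ≠ 0 := by exact_mod_cast Nat.factorial_ne_zero k
    have h2 : (k : ℝ) + 1 ≠ 0 := by positivity
    rw [Nat.factorial_succ]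
    push_cast at hg ⊢
    field_simp
    rw [pow_succ]
    linear_combination (-1 : ℝ) ^ k * hg
  · subst h; simp
  · rw [if_neg (by omega), if_neg (by omega)]; simp

open Polynomial in
theorem laguerrePoly_ode (n : ℕ) (α : ℝ) :
    X * derivative (derivative (laguerrePoly n α))
      + (C (α + 1) - X) * derivative (laguerrePoly n α) + C (n : ℝ) * laguerrePoly n α = 0 := by
  ext k
  have h := laguerrePoly_coeff_succ n α k
  rcases k with _ | k
  · simp [sub_mul, coeff_derivative] at h ⊢
    linear_combination h
  · simp only [sub_mul, coeff_add, coeff_sub, coeff_X_mul, coeff_C_mul, coeff_derivative,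
      coeff_zero] at h ⊢
    push_cast at h ⊢
    linear_combination h

theorem laguerrePoly_ode_eval (n : ℕ) (α x : ℝ) :
    x * (laguerrePoly n α).derivative.derivative.eval x
      + (α + 1 - x) * (laguerrePoly n α).derivative.eval x + n * (laguerrePoly n α).eval x = 0 := by
  have := congrArg (Polynomial.eval x) (laguerrePoly_ode n α)
  simpa using this

/-- The Laguerre function `e^{-x/2} x^{(α+1)/2} L_n^{(α)}(x)`. -/
noncomputable def laguerreFun (n : ℕ) (α x : ℝ) : ℝ :=
  Real.exp (-x / 2) * x ^ ((α + 1) / 2) * (laguerrePoly n α).eval x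

/-- The derivative of `laguerreFun` on `(0, ∞)`. -/
noncomputable def laguerreFunDeriv (n : ℕ) (α x : ℝ) : ℝ :=
  Real.exp (-x / 2) * x ^ ((α + 1) / 2) *
    ((laguerrePoly n α).derivative.eval x
      + (-1 / 2 + (α + 1) / (2 * x)) * (laguerrePoly n α).eval x)

/-- The potential in the normal form `u'' + Q u = 0` of the Laguerre equation. -/
noncomputable def laguerreQ (n : ℕ) (α x : ℝ) : ℝ :=
  (-x ^ 2 + 2 * (2 * n + α + 1) * x + 1 - α ^ 2) / (4 * x ^ 2)

theorem hasDerivAt_weight (α : ℝ) {x : ℝ} (hx : 0 < x) :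
    HasDerivAt (fun x : ℝ => Real.exp (-x / 2) * x ^ ((α + 1) / 2))
      (Real.exp (-x / 2) * x ^ ((α + 1) / 2) * (-1 / 2 + (α + 1) / (2 * x))) x := by
  have h1 : HasDerivAt (fun x : ℝ => Real.exp (-x / 2)) (Real.exp (-x / 2) * (-1 / 2)) x :=
    ((hasDerivAt_id x).neg.div_const 2).exp
  have h2 := Real.hasDerivAt_rpow_const (x := x) (p := (α + 1) / 2) (Or.inl hx.ne')
  refine (h1.mul h2).congr_deriv ?_
  rw [Real.rpow_sub_one hx.ne']
  field_simp

theorem hasDerivAt_laguerreFun (n : ℕ) (α : ℝ) {x : ℝ} (hx : 0 < x) :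
    HasDerivAt (laguerreFun n α) (laguerreFunDeriv n α x) x := by
  refine ((hasDerivAt_weight α hx).mul ((laguerrePoly n α).hasDerivAt x)).congr_deriv ?_
  rw [laguerreFunDeriv]
  ring

theorem hasDerivAt_laguerreFunDeriv (n : ℕ) (α : ℝ) {x : ℝ} (hx : 0 < x) :
    HasDerivAt (laguerreFunDeriv n α) (-laguerreQ n α x * laguerreFun n α x) x := by
  have h1 : HasDerivAt (fun x : ℝ => -1 / 2 + (α + 1) / (2 * x)) (-(α + 1) / (2 * x ^ 2)) x := by
    have h2 : HasDerivAt (fun x : ℝ => 2 * x) 2 x := by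
      simpa using (hasDerivAt_id x).const_mul 2
    refine (((hasDerivAt_const x (α + 1)).div h2 (by positivity)).const_add
      (-1 / 2)).congr_deriv ?_
    field_simp
    ring
  refine ((hasDerivAt_weight α hx).mul
    (((laguerrePoly n α).derivative.hasDerivAt x).add
      (h1.mul ((laguerrePoly n α).hasDerivAt x)))).congr_deriv ?_
  have h := laguerrePoly_ode_eval n α x
  have h3 : (laguerrePoly n α).derivative.derivative.eval x
      = -((α + 1 - x) * (laguerrePoly n α).derivative.eval x
          + n * (laguerrePoly n α).eval x) / x := by
    rw [eq_div_iff hx.ne']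
    linear_combination h
  simp only [laguerreQ, laguerreFun, Pi.add_apply, Pi.mul_apply]
  rw [h3]
  field_simp
  ring

theorem continuous_laguerreFun (n : ℕ) {α : ℝ} (hα : -1 < α) :
    Continuous (laguerreFun n α) := by
  unfold laguerreFun
  have : Continuous fun x : ℝ => x ^ ((α + 1) / 2) :=
    Real.continuous_rpow_const (by linarith)
  fun_prop

theorem laguerreFun_zero (n : ℕ) {α : ℝ} (hα : -1 < α) : laguerreFun n α 0 = 0 := by
  rw [laguerreFun, Real.zero_rpow (by linarith)]
  simp

theorem tendsto_laguerreFun_atTop (n : ℕ) (α : ℝ) :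
    Tendsto (laguerreFun n α) atTop (𝓝 0) := by
  have h : ∀ k ∈ Finset.range (n + 1), Tendsto (fun x : ℝ =>
      ((-1) ^ k * genBinom ((n : ℝ) + α) (n - k) / (Nat.factorial k)) *
        (x ^ ((α + 1) / 2 + k) * Real.exp (-(1 / 2) * x))) atTop (𝓝 0) := fun k _ => by
    simpa using (tendsto_rpow_mul_exp_neg_mul_atTop_nhds_zero ((α + 1) / 2 + k) (1 / 2)
      (by norm_num)).const_mul ((-1) ^ k * genBinom ((n : ℝ) + α) (n - k) / (Nat.factorial k))
  have h2 := tendsto_finsetSum _ h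
  rw [Finset.sum_const_zero] at h2
  refine h2.congr' ?_
  filter_upwards [eventually_gt_atTop 0] with x hx
  rw [laguerreFun, laguerrePoly, Polynomial.eval_finsetSum, Finset.mul_sum]
  refine Finset.sum_congr rfl fun k _ => ?_
  rw [Polynomial.eval_monomial, Real.rpow_add hx, Real.rpow_natCast,
    show -x / 2 = -(1 / 2) * x by ring]
  ring

theorem laguerreFun_eq_zero_iff (n : ℕ) (α : ℝ) {x : ℝ} (hx : 0 < x) :
    laguerreFun n α x = 0 ↔ laguerreL n α x = 0 := by
  have := (Real.rpow_pos_of_pos hx ((α + 1) / 2)).ne'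
  simp [laguerreFun, laguerrePoly_eval, this]

theorem laguerreFun_not_eqOn_zero (n : ℕ) (α : ℝ) {a b : ℝ} (ha : 0 ≤ a) (hab : a < b) :
    ¬ ∀ x ∈ Set.Ioo a b, laguerreFun n α x = 0 := by
  intro h
  refine laguerrePoly_ne_zero n α (Polynomial.eq_zero_of_infinite_isRoot _ ?_)
  refine (Set.Ioo_infinite hab).mono fun x hx => ?_
  have := (laguerreFun_eq_zero_iff n α (ha.trans_lt hx.1)).1 (h x hx)
  simpa [Polynomial.IsRoot, laguerrePoly_eval] using this

theorem genBinom_pos {t : ℝ} {m : ℕ} (h : (m : ℝ) < t + 1) : 0 < genBinom t m := by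
  refine div_pos (Finset.prod_pos fun i hi => ?_) (by exact_mod_cast Nat.factorial_pos m)
  have : ((i + 1 : ℕ) : ℝ) ≤ m := by exact_mod_cast Finset.mem_range.1 hi
  push_cast at this
  linarith

theorem laguerreL_pos_of_nonpos (n : ℕ) {α x : ℝ} (hα : -1 < α) (hx : x ≤ 0) :
    0 < laguerreL n α x := by
  have hb : ∀ k, 0 < genBinom ((n : ℝ) + α) (n - k) := fun k => by
    refine genBinom_pos ?_
    have : ((n - k : ℕ) : ℝ) ≤ n := by exact_mod_cast Nat.sub_le n k
    linarith
  have he : ∀ k, (-1) ^ k * genBinom ((n : ℝ) + α) (n - k) * x ^ k / (Nat.factorial k)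
      = genBinom ((n : ℝ) + α) (n - k) * (-x) ^ k / (Nat.factorial k) := fun k => by
    rw [neg_pow x]; ring
  simp only [laguerreL, he]
  refine Finset.sum_pos' (fun k _ => ?_) ⟨0, by simp, by simpa using hb 0⟩
  have : 0 ≤ -x := by linarith
  have := hb k
  positivity

theorem hasDerivAt_laguerreFun_mul_deriv (n : ℕ) (α : ℝ) {x : ℝ} (hx : 0 < x) :
    HasDerivAt (fun x => laguerreFun n α x * laguerreFunDeriv n α x)
      (laguerreFunDeriv n α x ^ 2 - laguerreQ n α x * laguerreFun n α x ^ 2) x := by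
  refine ((hasDerivAt_laguerreFun n α hx).mul (hasDerivAt_laguerreFunDeriv n α hx)).congr_deriv ?_
  ring

theorem hasDerivAt_laguerreFun_sq (n : ℕ) (α : ℝ) {x : ℝ} (hx : 0 < x) :
    HasDerivAt (fun x => laguerreFun n α x ^ 2)
      (2 * (laguerreFun n α x * laguerreFunDeriv n α x)) x := by
  refine ((hasDerivAt_laguerreFun n α hx).pow 2).congr_deriv ?_
  simp; ring

theorem laguerreL_ne_zero_of_laguerreQ_nonpos_right (n : ℕ) {α b : ℝ} (hb : 0 < b)
    (hQ : ∀ x, b ≤ x → laguerreQ n α x ≤ 0) : laguerreL n α b ≠ 0 := by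
  intro h0
  have hu0 := (laguerreFun_eq_zero_iff n α hb).2 h0
  have hpos : ∀ {x}, x ∈ Set.Ici b → 0 < x := fun hx => hb.trans_le hx
  have m1 : MonotoneOn (fun x => laguerreFun n α x * laguerreFunDeriv n α x) (Set.Ici b) := by
    refine monotoneOn_of_hasDerivWithinAt_nonneg (convex_Ici b)
      (fun x hx => (hasDerivAt_laguerreFun_mul_deriv n α (hpos hx)).continuousAt.continuousWithinAt)
      (fun x hx => (hasDerivAt_laguerreFun_mul_deriv n α
        (hpos (interior_subset hx))).hasDerivWithinAt) fun x hx => ?_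
    have := hQ x (interior_subset hx)
    nlinarith [sq_nonneg (laguerreFun n α x), sq_nonneg (laguerreFunDeriv n α x)]
  have m2 : MonotoneOn (fun x => laguerreFun n α x ^ 2) (Set.Ici b) := by
    refine monotoneOn_of_hasDerivWithinAt_nonneg (convex_Ici b)
      (fun x hx => (hasDerivAt_laguerreFun_sq n α (hpos hx)).continuousAt.continuousWithinAt)
      (fun x hx => (hasDerivAt_laguerreFun_sq n α
        (hpos (interior_subset hx))).hasDerivWithinAt) fun x hx => ?_
    have := m1 Set.self_mem_Ici (interior_subset hx) (interior_subset hx)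
    simp only [hu0, zero_mul] at this
    linarith
  have hlim : Tendsto (fun x => laguerreFun n α x ^ 2) atTop (𝓝 0) := by
    simpa using (tendsto_laguerreFun_atTop n α).pow 2
  refine laguerreFun_not_eqOn_zero n α hb.le (lt_add_one b) fun x hx => ?_
  have hle : laguerreFun n α x ^ 2 ≤ 0 := by
    refine ge_of_tendsto hlim ?_
    filter_upwards [eventually_ge_atTop x] with y hy
    exact m2 (Set.mem_Ici.2 hx.1.le) (Set.mem_Ici.2 (hx.1.le.trans hy)) hy
  exact pow_eq_zero_iff two_ne_zero |>.1 (le_antisymm hle (sq_nonneg _))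

theorem laguerreL_ne_zero_of_laguerreQ_nonpos_left (n : ℕ) {α b : ℝ} (hα : -1 < α) (hb : 0 < b)
    (hQ : ∀ x, 0 < x → x ≤ b → laguerreQ n α x ≤ 0) : laguerreL n α b ≠ 0 := by
  intro h0
  have hu0 := (laguerreFun_eq_zero_iff n α hb).2 h0
  have m1 : MonotoneOn (fun x => laguerreFun n α x * laguerreFunDeriv n α x) (Set.Ioc 0 b) := by
    refine monotoneOn_of_hasDerivWithinAt_nonneg (convex_Ioc 0 b)
      (fun x hx => (hasDerivAt_laguerreFun_mul_deriv n α hx.1).continuousAt.continuousWithinAt)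
      (fun x hx => (hasDerivAt_laguerreFun_mul_deriv n α
        (interior_subset hx).1).hasDerivWithinAt) fun x hx => ?_
    have := hQ x (interior_subset hx).1 (interior_subset hx).2
    nlinarith [sq_nonneg (laguerreFun n α x), sq_nonneg (laguerreFunDeriv n α x)]
  have m2 : AntitoneOn (fun x => laguerreFun n α x ^ 2) (Set.Icc 0 b) := by
    refine antitoneOn_of_hasDerivWithinAt_nonpos (convex_Icc 0 b)
      ((continuous_laguerreFun n hα).pow 2).continuousOn
      (fun x hx => (hasDerivAt_laguerreFun_sq n α
        (interior_Icc.subset hx).1).hasDerivWithinAt) fun x hx => ?_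
    rw [interior_Icc] at hx
    have := m1 ⟨hx.1, hx.2.le⟩ (Set.right_mem_Ioc.2 hb) hx.2.le
    simp only [hu0, zero_mul] at this
    linarith
  refine laguerreFun_not_eqOn_zero n α le_rfl hb fun x hx => ?_
  have hle := m2 (Set.left_mem_Icc.2 hb.le) ⟨hx.1.le, hx.2.le⟩ hx.1.le
  simp only [laguerreFun_zero n hα] at hle
  exact pow_eq_zero_iff two_ne_zero |>.1 (le_antisymm (by simpa using hle) (sq_nonneg _))

/-- A form of Sturm's comparison theorem, with comparison equation `v'' + m² v = 0`. -/
theorem exists_zero_of_sturm {u u' Q : ℝ → ℝ} {a b m : ℝ} (hm : 0 < m)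
    (hab : a + Real.pi / m ≤ b)
    (hu : ∀ x ∈ Set.Icc a b, HasDerivAt u (u' x) x)
    (hu' : ∀ x ∈ Set.Icc a b, HasDerivAt u' (-Q x * u x) x)
    (hQ : ∀ x ∈ Set.Icc a b, m ^ 2 ≤ Q x) : ∃ x ∈ Set.Icc a b, u x = 0 := by
  by_contra! hne
  have hpi : 0 < Real.pi / m := div_pos Real.pi_pos hm
  have hc : a + Real.pi / m ∈ Set.Icc a b := ⟨by linarith, hab⟩
  have ha : a ∈ Set.Icc a b := ⟨le_rfl, by linarith⟩
  have hsame : ∀ x ∈ Set.Icc a b, 0 < u a * u x := by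
    intro x hx
    by_contra! hneg
    have hcont : ContinuousOn (fun y => u a * u y) (Set.Icc a x) := fun y hy =>
      ((hu y ⟨hy.1, hy.2.trans hx.2⟩).continuousAt.const_mul (u a)).continuousWithinAt
    obtain ⟨y, hy, hy0⟩ := intermediate_value_Icc' hx.1 hcont ⟨hneg, mul_self_nonneg _⟩
    rcases mul_eq_zero.1 hy0 with h | h
    · exact hne a ha h
    · exact hne y ⟨hy.1, hy.2.trans hx.2⟩ h
  have hsub : Set.Icc a (a + Real.pi / m) ⊆ Set.Icc a b := Set.Icc_subset_Icc_right hab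
  have hW : ∀ x ∈ Set.Icc a (a + Real.pi / m), HasDerivAt
      (fun x => u a * (u x * (m * Real.cos (m * (x - a))) - u' x * Real.sin (m * (x - a))))
      ((Q x - m ^ 2) * (u a * u x) * Real.sin (m * (x - a))) x := by
    intro x hx
    have hl : HasDerivAt (fun x => m * (x - a)) m x := by
      simpa using ((hasDerivAt_id x).sub_const a).const_mul m
    refine ((((hu x (hsub hx)).mul (hl.cos.const_mul m)).sub
      ((hu' x (hsub hx)).mul hl.sin)).const_mul (u a)).congr_deriv ?_
    ring
  have hmono : MonotoneOn
      (fun x => u a * (u x * (m * Real.cos (m * (x - a))) - u' x * Real.sin (m * (x - a))))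
      (Set.Icc a (a + Real.pi / m)) := by
    refine monotoneOn_of_hasDerivWithinAt_nonneg (convex_Icc _ _)
      (fun x hx => (hW x hx).continuousAt.continuousWithinAt)
      (fun x hx => (hW x (interior_subset hx)).hasDerivWithinAt) fun x hx => ?_
    have hx := interior_subset hx
    refine mul_nonneg (mul_nonneg ?_ (hsame x (hsub hx)).le) ?_
    · linarith [hQ x (hsub hx)]
    · refine Real.sin_nonneg_of_nonneg_of_le_pi (mul_nonneg hm.le (by linarith [hx.1])) ?_
      have : x - a ≤ Real.pi / m := by linarith [hx.2]
      rwa [le_div_iff₀ hm, mul_comm] at this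
  have hle := hmono (Set.left_mem_Icc.2 hc.1) (Set.right_mem_Icc.2 hc.1) hc.1
  have e : m * (a + Real.pi / m - a) = Real.pi := by field_simp; ring
  simp only [sub_self, mul_zero, Real.cos_zero, Real.sin_zero, e, Real.cos_pi, Real.sin_pi] at hle
  nlinarith [mul_pos hm (hsame a ha), mul_pos hm (hsame _ hc)]

theorem laguerre_zero_scaled_le {n : ℕ} {α ε w x : ℝ} (hα : 0 < α) (hw : 0 < w)
    (hw2 : w ^ 2 = n * α) (h1 : 2 * (2 * n + 1) ≤ ε * w) (h2 : 2 * α + 1 ≤ ε * w ^ 2)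
    (hx : laguerreL n α x = 0) : |x - α| ≤ (2 + ε) * w := by
  have hx0 : 0 < x := by
    by_contra! h
    exact (laguerreL_pos_of_nonpos n (by linarith) h).ne' hx
  have key : ∀ y, (2 + ε) * w ≤ |y - α| → laguerreQ n α y ≤ 0 := by
    intro y hy
    refine div_nonpos_of_nonpos_of_nonneg ?_ (by positivity)
    set d := y - α with hd
    have e : -y ^ 2 + 2 * (2 * n + α + 1) * y + 1 - α ^ 2
        = -|d| ^ 2 + 2 * (2 * n + 1) * d + 4 * w ^ 2 + (2 * α + 1) := by
      rw [sq_abs, hw2, hd]; ring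
    have h3 : 2 * (2 * n + 1) * d ≤ ε * w * |d| :=
      (mul_le_mul_of_nonneg_left (le_abs_self d) (by positivity)).trans
        (mul_le_mul_of_nonneg_right h1 (abs_nonneg d))
    rw [e]
    nlinarith [mul_nonneg (sub_nonneg.2 hy) (by positivity : 0 ≤ |d| + 2 * w)]
  by_contra! hlt
  rcases le_total α x with h | h
  · refine laguerreL_ne_zero_of_laguerreQ_nonpos_right n hx0 (fun y hy => key y ?_) hx
    rw [abs_of_nonneg (by linarith)] at hlt ⊢
    linarith
  · refine laguerreL_ne_zero_of_laguerreQ_nonpos_left n (by linarith) hx0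
      (fun y _ hy => key y ?_) hx
    rw [abs_of_nonpos (by linarith)] at hlt ⊢
    linarith

theorem exists_laguerre_zero_scaled {n : ℕ} {α δ ρ w t : ℝ} (hδ : 0 < δ) (hδ2 : δ ≤ 1)
    (hρ : 0 < ρ) (hn : 1 ≤ n) (hα : 5 * n ≤ α) (hw : 0 < w) (hw2 : w ^ 2 = n * α)
    (h1 : 2 * (2 * n + 1) ≤ δ / 2 * w) (ht : |t| + ρ ≤ 2 - δ)
    (hlarge : 3 * Real.pi ≤ n * (√δ * ρ)) :
    ∃ x, laguerreL n α x = 0 ∧ |(x - α) / w - t| ≤ ρ := by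
  have hn' : (1 : ℝ) ≤ n := by exact_mod_cast hn
  have hα0 : 0 < α := by linarith
  have hwα : 2 * w < α := by
    refine lt_of_pow_lt_pow_left₀ 2 hα0.le ?_
    nlinarith
  have hd : ∀ x ∈ Set.Icc (α + (t - ρ) * w) (α + (t + ρ) * w), |x - α| ≤ (2 - δ) * w := by
    intro x hx
    have := le_abs_self t
    have := neg_abs_le t
    rw [abs_le]
    constructor
    · nlinarith [hx.1]
    · nlinarith [hx.2]
  have hpos : ∀ x ∈ Set.Icc (α + (t - ρ) * w) (α + (t + ρ) * w), 0 < x := by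
    intro x hx
    have := (abs_le.1 (hd x hx)).1
    nlinarith
  have hsδ : 0 < √δ := Real.sqrt_pos.2 hδ
  have hm : 0 < √δ * w / (6 * α) := by positivity
  obtain ⟨x, hx, hx0⟩ := exists_zero_of_sturm (u := laguerreFun n α) (u' := laguerreFunDeriv n α)
    (Q := laguerreQ n α) (a := α + (t - ρ) * w) (b := α + (t + ρ) * w) hm
    (by
      have : Real.pi / (√δ * w / (6 * α)) ≤ 2 * ρ * w := by
        rw [div_le_iff₀ hm]
        have : 2 * ρ * w * (√δ * w / (6 * α)) = n * (√δ * ρ) / 3 := by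
          field_simp
          rw [hw2]; ring
        linarith
      linarith)
    (fun x hx => hasDerivAt_laguerreFun n α (hpos x hx))
    (fun x hx => hasDerivAt_laguerreFunDeriv n α (hpos x hx))
    (by
      intro x hx
      have hx0 := hpos x hx
      have hxd := hd x hx
      set d := x - α with hd
      have hx2 : x ≤ 2 * α := by
        have := (abs_le.1 hxd).2
        nlinarith
      have e : -x ^ 2 + 2 * (2 * n + α + 1) * x + 1 - α ^ 2
          = -|d| ^ 2 + 2 * (2 * n + 1) * d + 4 * w ^ 2 + (2 * α + 1) := by
        rw [sq_abs, hw2, hd]; ring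
      have h3 : -(δ / 2 * w * ((2 - δ) * w)) ≤ 2 * (2 * n + 1) * d := by
        have h4 : 2 * (2 * n + 1) * -d ≤ δ / 2 * w * ((2 - δ) * w) :=
          (mul_le_mul_of_nonneg_left ((neg_le_abs d).trans hxd) (by positivity)).trans
            (mul_le_mul_of_nonneg_right h1 (by nlinarith))
        linarith
      have h5 : |d| ^ 2 ≤ ((2 - δ) * w) ^ 2 := by gcongr
      have h6 : δ * w ^ 2 ≤ -x ^ 2 + 2 * (2 * n + α + 1) * x + 1 - α ^ 2 := by
        rw [e]
        nlinarith [mul_pos hδ (pow_pos hw 2), mul_nonneg (mul_nonneg hδ.le (sub_nonneg.2 hδ2))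
          (pow_pos hw 2).le]
      rw [laguerreQ, div_pow, mul_pow, Real.sq_sqrt hδ.le]
      refine div_le_div₀ (h6.trans' (by positivity)) h6 (by positivity) ?_
      nlinarith)
  refine ⟨x, (laguerreFun_eq_zero_iff n α (hpos x hx)).1 hx0, ?_⟩
  have : (x - α) / w - t = (x - α - t * w) / w := by field_simp
  rw [this, abs_div, abs_of_pos hw, div_le_iff₀ hw, abs_le]
  constructor <;> nlinarith [hx.1, hx.2]

theorem eventually_laguerre_scale {α : ℕ → ℝ}
    (hαlim : Tendsto (fun n : ℕ => α n / n) atTop atTop) {η : ℝ} (hη : 0 < η) :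
    ∀ᶠ n : ℕ in atTop, 1 ≤ n ∧ 5 * n ≤ α n ∧ 0 < √(n * α n) ∧ √(n * α n) ^ 2 = n * α n ∧
      2 * (2 * n + 1) ≤ η * √(n * α n) ∧ 2 * α n + 1 ≤ η * √(n * α n) ^ 2 := by
  filter_upwards [eventually_ge_atTop 1, hαlim.eventually_ge_atTop 5,
    hαlim.eventually_ge_atTop (36 / η ^ 2),
    tendsto_natCast_atTop_atTop.eventually_ge_atTop (3 / η)] with n hn h5 h36 h3
  have hn' : (1 : ℝ) ≤ n := by exact_mod_cast hn
  have hn0 : (0 : ℝ) < n := by linarith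
  rw [le_div_iff₀ hn0] at h5
  rw [div_le_div_iff₀ (by positivity) hn0] at h36
  rw [div_le_iff₀ hη] at h3
  have hα0 : 0 < α n := by linarith
  have hw2 : √(n * α n) ^ 2 = n * α n := Real.sq_sqrt (by positivity)
  have hw : 0 < √(n * α n) := Real.sqrt_pos.2 (by positivity)
  refine ⟨hn, h5, hw, hw2, ?_, ?_⟩
  · have : 6 * (n : ℝ) ≤ η * √(n * α n) := by
      refine le_of_sq_le_sq ?_ (by positivity)
      rw [mul_pow, mul_pow, hw2]
      nlinarith
    linarith
  · rw [hw2]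
    nlinarith

theorem eventually_laguerre_zero_le {α : ℕ → ℝ}
    (hαlim : Tendsto (fun n : ℕ => α n / n) atTop atTop) {ε : ℝ} (hε : 0 < ε) :
    ∀ᶠ n : ℕ in atTop, ∀ x, laguerreL n (α n) x = 0 → |(x - α n) / √(n * α n)| ≤ 2 + ε := by
  filter_upwards [eventually_laguerre_scale hαlim hε] with n ⟨hn, h5, hw, hw2, h1, h2⟩ x hx
  have hn' : (1 : ℝ) ≤ n := by exact_mod_cast hn
  rw [abs_div, abs_of_pos hw, div_le_iff₀ hw]
  exact laguerre_zero_scaled_le (by linarith) hw hw2 h1 h2 hx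

theorem eventually_exists_laguerre_zero {α : ℕ → ℝ}
    (hαlim : Tendsto (fun n : ℕ => α n / n) atTop atTop) {t : ℝ} (ht : |t| ≤ 2) {ε : ℝ}
    (hε : 0 < ε) :
    ∀ᶠ n : ℕ in atTop, 1 ≤ n ∧
      ∃ x, laguerreL n (α n) x = 0 ∧ |(x - α n) / √(n * α n) - t| < ε := by
  obtain ⟨δ, hδ, hδ1, hδε⟩ : ∃ δ : ℝ, 0 < δ ∧ δ ≤ 1 / 2 ∧ 3 * δ < ε :=
    ⟨min (1 / 2) (ε / 4), by positivity, min_le_left _ _, by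
      linarith [min_le_right (1 / 2) (ε / 4)]⟩
  have hlim : Tendsto (fun n : ℕ => (n : ℝ) * (√δ * δ)) atTop atTop :=
    tendsto_natCast_atTop_atTop.atTop_mul_const (by positivity)
  filter_upwards [eventually_laguerre_scale hαlim (half_pos hδ),
    hlim.eventually_ge_atTop (3 * Real.pi)] with n ⟨hn, h5, hw, hw2, h1, _⟩ hl
  refine ⟨hn, ?_⟩
  obtain ⟨x, hx, hxt⟩ := exists_laguerre_zero_scaled (t := (1 - δ) * t) hδ (by linarith) hδ hn h5 hw
    hw2 h1 (by rw [abs_mul, abs_of_pos (by linarith)]; nlinarith) hl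
  refine ⟨x, hx, ?_⟩
  have e : (x - α n) / √(n * α n) - t = ((x - α n) / √(n * α n) - (1 - δ) * t) + -(δ * t) := by ring
  have h7 : |-(δ * t)| ≤ 2 * δ := by
    rw [abs_neg, abs_mul, abs_of_pos hδ]; nlinarith
  rw [e]
  linarith [abs_add_le ((x - α n) / √(n * α n) - (1 - δ) * t) (-(δ * t))]

theorem stmt14 (α : ℕ → ℝ)
    (hα : ∀ n, α n > -1)
    (hαlim : Tendsto (fun n : ℕ => α n / n) atTop atTop)
    (r s : ℕ → ℝ)
    (hr : ∀ n : ℕ, 1 ≤ n → IsLeast {x : ℝ | laguerreL n (α n) x = 0} (r n))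
    (hs : ∀ n : ℕ, 1 ≤ n → IsGreatest {x : ℝ | laguerreL n (α n) x = 0} (s n)) :
    Tendsto (fun n : ℕ => (s n - α n) / Real.sqrt ((n : ℝ) * α n)) atTop (𝓝 2) ∧
    Tendsto (fun n : ℕ => (r n - α n) / Real.sqrt ((n : ℝ) * α n)) atTop (𝓝 (-2)) ∧
    Set.Icc (-2 : ℝ) 2 ⊆
      closure (⋃ n : ℕ, ⋃ _ : 1 ≤ n,
        (fun x => (x - α n) / Real.sqrt ((n : ℝ) * α n)) ''
          {x : ℝ | laguerreL n (α n) x = 0}) := by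
  refine ⟨?_, ?_, ?_⟩
  · rw [Metric.tendsto_nhds]
    intro ε hε
    filter_upwards [eventually_laguerre_zero_le hαlim (half_pos hε),
      eventually_exists_laguerre_zero hαlim (t := 2) (by norm_num) hε]
      with n h1 ⟨hn, x, hx, hxt⟩
    have h2 := (abs_le.1 (h1 _ (hs n hn).1)).2
    have h3 : (x - α n) / √(n * α n) ≤ (s n - α n) / √(n * α n) := by
      have := (hs n hn).2 hx
      gcongr
    rw [Real.dist_eq, abs_lt]
    constructor <;> linarith [(abs_lt.1 hxt).1]
  · rw [Metric.tendsto_nhds]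
    intro ε hε
    filter_upwards [eventually_laguerre_zero_le hαlim (half_pos hε),
      eventually_exists_laguerre_zero hαlim (t := -2) (by norm_num) hε]
      with n h1 ⟨hn, x, hx, hxt⟩
    have h2 := (abs_le.1 (h1 _ (hr n hn).1)).1
    have h3 : (r n - α n) / √(n * α n) ≤ (x - α n) / √(n * α n) := by
      have := (hr n hn).2 hx
      gcongr
    rw [Real.dist_eq, abs_lt]
    constructor <;> linarith [(abs_lt.1 hxt).2]
  · intro t ht
    rw [Metric.mem_closure_iff]
    intro ε hε
    obtain ⟨n, hn, x, hx, hxt⟩ :=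
      (eventually_exists_laguerre_zero hαlim (abs_le.2 ht) hε).exists
    refine ⟨(x - α n) / √(n * α n), ?_, ?_⟩
    · simp only [Set.mem_iUnion]
      exact ⟨n, hn, x, hx, rfl⟩
    · rwa [dist_comm, Real.dist_eq]
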